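/- arXiv:2301.10853 — 4 statements merged into one kernel-verified Lean document; each statement's English description precedes it below -/
import Mathlib

section
/- Let n ≥ 1 and let f : ℝⁿ → ℝ be continuous, twice continuously differentiable on a neighborhood of a point x₀, with f(x₀) = 0, f(x) > 0 for all x ≠ x₀, and positive-definite Hessian H := Hess f(x₀). Then for every compactly supported continuous function φ : ℝⁿ → ℝ one has lim_{t→∞} ∫_{ℝⁿ} φ(x) · (t/(2π))^{n/2} · √(det H) · e^{−t f(x)} dx = φ(x₀); that is, the measures √(det((t/(2π))·H)) e^{−t f(x)} dx converge weakly to the Dirac measure at x₀ as t → ∞. -/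
open Filter MeasureTheory
open scoped Topology

/-- Second-order Taylor expansion with Peano remainder, for functions on a real normed space. -/
theorem ContDiffAt.isLittleO_taylor_two {E : Type*} [NormedAddCommGroup E] [NormedSpace ℝ E]
    {f : E → ℝ} {x₀ : E} (hf : ContDiffAt ℝ 2 f x₀) :
    (fun x => f x - f x₀ - fderiv ℝ f x₀ (x - x₀)
      - 1 / 2 * fderiv ℝ (fderiv ℝ f) x₀ (x - x₀) (x - x₀)) =o[𝓝 x₀] fun x => ‖x - x₀‖ ^ 2 := by
  set B := fderiv ℝ (fderiv ℝ f) x₀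
  have hsymm : ∀ v w, B v w = B w v := fun v w =>
    (hf.isSymmSndFDerivAt (by simp)).eq v w
  have hB' : HasFDerivAt (fderiv ℝ f) B x₀ :=
    ((hf.fderiv_right (m := 1) (by norm_num)).differentiableAt (by simp)).hasFDerivAt
  have hdiff : ∀ᶠ x in 𝓝 x₀, DifferentiableAt ℝ f x :=
    (hf.eventually (by simp)).mono fun x hx => hx.differentiableAt (by simp)
  obtain ⟨ε, hε, hball⟩ := Metric.eventually_nhds_iff_ball.1 hdiff
  have hmem : Metric.ball x₀ ε ∈ 𝓝 x₀ := Metric.ball_mem_nhds x₀ hε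
  have key := (convex_ball x₀ ε).isLittleO_pow_succ (n := 1) (Metric.mem_ball_self hε)
    (f := fun x => f x - fderiv ℝ f x₀ (x - x₀) - 1 / 2 * B (x - x₀) (x - x₀))
    (f' := fun x => fderiv ℝ f x - fderiv ℝ f x₀ - B (x - x₀)) ?_ ?_
  · rw [nhdsWithin_eq_nhds.2 hmem] at key
    refine key.congr_left fun x => ?_
    simp
    ring
  · intro x hx
    have h0 : HasFDerivAt (fun x : E => x - x₀) (ContinuousLinearMap.id ℝ E) x :=
      (hasFDerivAt_id x).sub_const x₀
    have h1 := (fderiv ℝ f x₀).hasFDerivAt.comp x h0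
    have h2 := ((B.hasFDerivAt.comp x h0).clm_apply h0).const_mul (1 / 2 : ℝ)
    refine (((hball x hx).hasFDerivAt.sub h1).sub h2).hasFDerivWithinAt.congr_fderiv ?_
    ext v
    change fderiv ℝ f x v - fderiv ℝ f x₀ v - 1 / 2 * (B (x - x₀) v + B v (x - x₀))
      = fderiv ℝ f x v - fderiv ℝ f x₀ v - B (x - x₀) v
    rw [hsymm v]
    ring
  · rw [nhdsWithin_eq_nhds.2 hmem]
    simpa using hB'.isLittleO.norm_right

/-- The quadratic form of a positive definite matrix is the squared norm of an invertible linear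
image, whose determinant is the square root of that of the matrix. -/
theorem Matrix.PosDef.exists_continuousLinearEquiv {ι : Type*} [Fintype ι] [DecidableEq ι]
    {H : Matrix ι ι ℝ} (hH : H.PosDef) :
    ∃ L : EuclideanSpace ℝ ι ≃L[ℝ] EuclideanSpace ℝ ι,
      (∀ v, ‖L v‖ ^ 2 = v ⬝ᵥ H.mulVec v) ∧
      |LinearMap.det (L : EuclideanSpace ℝ ι →ₗ[ℝ] EuclideanSpace ℝ ι)| = √H.det := by
  open scoped MatrixOrder in
  obtain ⟨B, hB⟩ := CStarAlgebra.nonneg_iff_eq_star_mul_self.mp hH.posSemidef.nonneg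
  have hdet : LinearMap.det (Matrix.toEuclideanLin B) = B.det := by
    rw [Matrix.toEuclideanLin_eq_toLin_orthonormal, LinearMap.det_toLin]
  have hHdet : H.det = B.det ^ 2 := by
    rw [hB, Matrix.det_mul, Matrix.star_eq_conjTranspose, Matrix.det_conjTranspose]
    simp [sq]
  have hBdet : B.det ≠ 0 := fun h => hH.det_pos.ne' (by simp [hHdet, h])
  refine ⟨((Matrix.toEuclideanLin B).equivOfDetNeZero
    (hdet ▸ hBdet)).toContinuousLinearEquiv, fun v => ?_, ?_⟩
  · rw [← Matrix.inner_toEuclideanCLM, hB, map_mul, map_star,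
      ContinuousLinearMap.star_eq_adjoint, mul_apply_eq_comp,
      ContinuousLinearMap.adjoint_inner_right, real_inner_self_eq_norm_sq]
    rfl
  · rw [hHdet, Real.sqrt_sq_eq_abs]
    exact congrArg abs hdet

section

variable {E : Type*} [NormedAddCommGroup E] [NormedSpace ℝ E]

/-- A function with a unique zero that is a nondegenerate minimum dominates a multiple of the
squared distance to that zero on every compact set. -/
theorem IsCompact.exists_mul_sq_norm_le {f : E → ℝ} (hf : Continuous f) {x₀ : E}
    (hpos : ∀ x, x ≠ x₀ → 0 < f x) (L : E ≃L[ℝ] E)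
    (hL : (fun x => f x - 1 / 2 * ‖L (x - x₀)‖ ^ 2) =o[𝓝 x₀] fun x => ‖x - x₀‖ ^ 2)
    {K : Set E} (hK : IsCompact K) :
    ∃ c > 0, ∀ x ∈ K, c * ‖x - x₀‖ ^ 2 ≤ f x := by
  obtain ⟨a, ha, hLa⟩ : ∃ a > 0, ∀ v, a * ‖v‖ ^ 2 ≤ ‖L v‖ ^ 2 := by
    set M := ‖(L.symm : E →L[ℝ] E)‖ + 1
    have hMpos : 0 < M := by positivity
    refine ⟨(M ^ 2)⁻¹, by positivity, fun v => ?_⟩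
    have h : ‖v‖ ≤ M * ‖L v‖ := by
      have := (L.symm : E →L[ℝ] E).le_opNorm (L v)
      simp only [ContinuousLinearEquiv.coe_coe, ContinuousLinearEquiv.symm_apply_apply] at this
      nlinarith [norm_nonneg (L v)]
    rw [inv_mul_le_iff₀ (by positivity), ← mul_pow]
    gcongr
  obtain ⟨ε, hε, hball⟩ := Metric.eventually_nhds_iff_ball.1
    (hL.bound (show 0 < a / 4 by positivity))
  obtain ⟨m, hm, hmle⟩ := (hK.diff (Metric.isOpen_ball (x := x₀) (ε := ε))).exists_forall_le'
    (f := fun x => f x / ‖x - x₀‖ ^ 2) (a := 0)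
    (hf.continuousOn.div (by fun_prop) fun x hx h => by
      have : x = x₀ := by simpa [sub_eq_zero] using h
      exact hx.2 (this ▸ Metric.mem_ball_self hε))
    (fun x hx => by
      have hne : x ≠ x₀ := fun h => hx.2 (h ▸ Metric.mem_ball_self hε)
      have := norm_pos_iff.2 (sub_ne_zero.2 hne)
      exact div_pos (hpos x hne) (by positivity))
  refine ⟨min m (a / 4), by positivity, fun x hx => ?_⟩
  by_cases hxb : x ∈ Metric.ball x₀ ε
  · have h1 := hball x hxb
    rw [Real.norm_eq_abs, Real.norm_of_nonneg (by positivity)] at h1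
    have h2 := neg_le_of_abs_le h1
    have h3 := hLa (x - x₀)
    have h4 : min m (a / 4) * ‖x - x₀‖ ^ 2 ≤ a / 4 * ‖x - x₀‖ ^ 2 := by
      gcongr
      exact min_le_right _ _
    linarith
  · have hne : x ≠ x₀ := fun h => hxb (h ▸ Metric.mem_ball_self hε)
    have := norm_pos_iff.2 (sub_ne_zero.2 hne)
    have h1 := (le_div_iff₀ (by positivity)).1 (hmle x ⟨hx, hxb⟩)
    refine le_trans ?_ h1
    gcongr
    exact min_le_left _ _

/-- Rescaling a function about a point where it has a purely quadratic second-order expansion. -/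
theorem tendsto_sq_mul_comp_add_inv_smul {f : E → ℝ} {x₀ : E} (L : E ≃L[ℝ] E)
    (hL : (fun x => f x - 1 / 2 * ‖L (x - x₀)‖ ^ 2) =o[𝓝 x₀] fun x => ‖x - x₀‖ ^ 2) (y : E) :
    Tendsto (fun s : ℝ => s ^ 2 * f (x₀ + s⁻¹ • y)) atTop (𝓝 (1 / 2 * ‖L y‖ ^ 2)) := by
  have hx : Tendsto (fun s : ℝ => x₀ + s⁻¹ • y) atTop (𝓝 x₀) := by
    simpa using ((tendsto_inv_atTop_zero (𝕜 := ℝ)).smul_const y).const_add x₀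
  have h1 := hL.comp_tendsto hx
  have h2 : (fun s : ℝ => s ^ 2 * f (x₀ + s⁻¹ • y) - 1 / 2 * ‖L y‖ ^ 2) =o[atTop]
      fun _ => ‖y‖ ^ 2 := by
    refine ((Asymptotics.isBigO_refl (fun s : ℝ => s ^ 2) atTop).mul_isLittleO h1).congr' ?_ ?_
    · filter_upwards [eventually_gt_atTop 0] with s hs
      simp only [Function.comp, add_sub_cancel_left, map_smul, norm_smul, norm_inv,
        Real.norm_of_nonneg hs.le]
      field_simp
    · filter_upwards [eventually_gt_atTop 0] with s hs
      simp only [Function.comp, add_sub_cancel_left, norm_smul, norm_inv,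
        Real.norm_of_nonneg hs.le]
      field_simp
  refine tendsto_sub_nhds_zero_iff.1 ?_
  exact (h2.trans_isBigO (Asymptotics.isBigO_const_const _ one_ne_zero _)).tendsto_zero_of_tendsto
    (tendsto_const_nhds (x := (1 : ℝ)))

end

section

variable {E : Type*} [NormedAddCommGroup E] [InnerProductSpace ℝ E] [FiniteDimensional ℝ E]
  [MeasurableSpace E] [BorelSpace E]

/-- The Gaussian function `exp (-b ‖v‖²)` is integrable. -/
theorem integrable_rexp_neg_mul_sq_norm {b : ℝ} (hb : 0 < b) :
    Integrable fun v : E => Real.exp (-b * ‖v‖ ^ 2) := by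
  have h := (GaussianFourier.integrable_cexp_neg_mul_sq_norm_add (V := E) (b := b)
    (by simpa using hb) 0 0).norm
  refine h.congr (Eventually.of_forall fun v => ?_)
  simp [Complex.norm_exp, ← Complex.ofReal_pow]

/-- Gaussian integral of the pullback of the squared norm by a linear automorphism. -/
theorem integral_rexp_neg_half_sq_norm_comp (L : E ≃L[ℝ] E) :
    ∫ v : E, Real.exp (-(1 / 2 * ‖L v‖ ^ 2)) =
      |LinearMap.det (L : E →ₗ[ℝ] E)|⁻¹ * (2 * Real.pi) ^ (Module.finrank ℝ E / 2 : ℝ) := by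
  have hdet : LinearMap.det (L : E →ₗ[ℝ] E) ≠ 0 :=
    (LinearEquiv.isUnit_det' L.toLinearEquiv).ne_zero
  have hmap := Measure.map_linearMap_addHaar_eq_smul_addHaar (volume : Measure E) hdet
  have h1 := integral_map_equiv (μ := (volume : Measure E)) L.toHomeomorph.toMeasurableEquiv
    fun v : E => Real.exp (-(1 / 2 : ℝ) * ‖v‖ ^ 2)
  change ∫ y, _ ∂Measure.map (L : E →ₗ[ℝ] E) volume = ∫ x : E, Real.exp (-(1 / 2 : ℝ) * ‖L x‖ ^ 2)
    at h1
  rw [hmap, integral_smul_measure, GaussianFourier.integral_rexp_neg_mul_sq_norm (by norm_num),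
    ENNReal.toReal_ofReal (abs_nonneg _), abs_inv, smul_eq_mul] at h1
  simp only [neg_mul] at h1
  rw [← h1]
  congr 2
  ring

/-- Laplace's method on a finite-dimensional inner product space, at a nondegenerate minimum whose
Hessian is the pullback of the inner product by `L`. -/
theorem tendsto_rpow_mul_integral_mul_rexp_neg_mul {f : E → ℝ} (hf : Continuous f) {x₀ : E}
    (hpos : ∀ x, x ≠ x₀ → 0 < f x) (L : E ≃L[ℝ] E)
    (hL : (fun x => f x - 1 / 2 * ‖L (x - x₀)‖ ^ 2) =o[𝓝 x₀] fun x => ‖x - x₀‖ ^ 2)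
    {φ : E → ℝ} (hφ : Continuous φ) (hφs : HasCompactSupport φ) :
    Tendsto (fun t : ℝ => t ^ (Module.finrank ℝ E / 2 : ℝ) * ∫ x, φ x * Real.exp (-t * f x))
      atTop (𝓝 (φ x₀ * ∫ v, Real.exp (-(1 / 2 * ‖L v‖ ^ 2)))) := by
  obtain ⟨c, hc, hcf⟩ := IsCompact.exists_mul_sq_norm_le hf hpos L hL hφs
  obtain ⟨C, hC⟩ := hφ.bounded_above_of_compact_support hφs
  have hrescale : Tendsto (fun s : ℝ => ∫ y, φ (x₀ + s⁻¹ • y) *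
      Real.exp (-(s ^ 2 * f (x₀ + s⁻¹ • y)))) atTop
      (𝓝 (∫ v, φ x₀ * Real.exp (-(1 / 2 * ‖L v‖ ^ 2)))) := by
    refine tendsto_integral_filter_of_dominated_convergence
      (fun y => C * Real.exp (-c * ‖y‖ ^ 2)) ?_ ?_
      ((integrable_rexp_neg_mul_sq_norm hc).const_mul C) ?_
    · refine Eventually.of_forall fun s => Continuous.aestronglyMeasurable ?_
      fun_prop
    · filter_upwards [eventually_gt_atTop 0] with s hs
      refine Eventually.of_forall fun y => ?_
      rw [norm_mul, Real.norm_of_nonneg (Real.exp_pos _).le]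
      by_cases hy : x₀ + s⁻¹ • y ∈ tsupport φ
      · have h := hcf _ hy
        rw [add_sub_cancel_left, norm_smul, norm_inv, Real.norm_of_nonneg hs.le] at h
        gcongr
        · exact (norm_nonneg _).trans (hC x₀)
        · exact hC _
        · have h' := mul_le_mul_of_nonneg_left h (sq_nonneg s)
          have : s ^ 2 * (c * (s⁻¹ * ‖y‖) ^ 2) = c * ‖y‖ ^ 2 := by field_simp
          linarith
      · rw [image_eq_zero_of_notMem_tsupport hy, norm_zero, zero_mul]
        exact mul_nonneg ((norm_nonneg _).trans (hC x₀)) (Real.exp_pos _).le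
    · refine Eventually.of_forall fun y => ?_
      have hx : Tendsto (fun s : ℝ => x₀ + s⁻¹ • y) atTop (𝓝 x₀) := by
        simpa using ((tendsto_inv_atTop_zero (𝕜 := ℝ)).smul_const y).const_add x₀
      exact ((hφ.tendsto x₀).comp hx).mul
        ((Real.continuous_exp.tendsto _).comp (tendsto_sq_mul_comp_add_inv_smul L hL y).neg)
  rw [integral_const_mul] at hrescale
  refine (hrescale.comp Real.tendsto_sqrt_atTop).congr' ?_
  filter_upwards [eventually_gt_atTop 0] with t ht
  have hpow : √t ^ Module.finrank ℝ E = t ^ (Module.finrank ℝ E / 2 : ℝ) := by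
    rw [Real.sqrt_eq_rpow, ← Real.rpow_natCast, ← Real.rpow_mul ht.le]
    congr 1
    ring
  simp only [Function.comp, Real.sq_sqrt ht.le]
  rw [Measure.integral_comp_inv_smul_of_nonneg volume
    (fun y => φ (x₀ + y) * Real.exp (-(t * f (x₀ + y)))) (Real.sqrt_nonneg t),
    integral_add_left_eq_self (fun y => φ y * Real.exp (-(t * f y))) x₀, hpow, smul_eq_mul]
  simp only [neg_mul]

end

/-- **Laplace approximation** (part (i) of the Laplace approximation lemma).
If `f : ℝⁿ → ℝ` is continuous, twice continuously differentiable near `x₀`, vanishes at `x₀`,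
is positive elsewhere, and has positive-definite Hessian `H` at `x₀`, then the measures
`(t/(2π))^{n/2} √(det H) e^{-t f(x)} dx` converge weakly to the Dirac measure at `x₀`. -/
theorem laplace_approximation
    (n : ℕ) (hn : 1 ≤ n)
    (f : EuclideanSpace ℝ (Fin n) → ℝ) (hf_cont : Continuous f)
    (x₀ : EuclideanSpace ℝ (Fin n))
    (hf_C2 : ∃ U ∈ nhds x₀, ContDiffOn ℝ 2 f U)
    (hf0 : f x₀ = 0) (hfpos : ∀ x, x ≠ x₀ → 0 < f x)
    (H : Matrix (Fin n) (Fin n) ℝ)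
    (hH : H = Matrix.of fun i j =>
      iteratedFDeriv ℝ 2 f x₀ ![EuclideanSpace.single i 1, EuclideanSpace.single j 1])
    (hHpd : H.PosDef)
    (φ : EuclideanSpace ℝ (Fin n) → ℝ) (hφc : Continuous φ) (hφs : HasCompactSupport φ) :
    Tendsto
      (fun t : ℝ => ∫ x, φ x *
        ((t / (2 * Real.pi)) ^ ((n : ℝ) / 2) * Real.sqrt H.det * Real.exp (-t * f x)))
      atTop (nhds (φ x₀)) := by
  obtain ⟨U, hU, hfU⟩ := hf_C2
  obtain ⟨L, hLH, hLdet⟩ := hHpd.exists_continuousLinearEquiv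
  have hmin : IsLocalMin f x₀ := Eventually.of_forall fun x => by
    rcases eq_or_ne x x₀ with rfl | hx
    · rfl
    · exact hf0.trans_le (hfpos x hx).le
  have hquad : ∀ v : EuclideanSpace ℝ (Fin n),
      fderiv ℝ (fderiv ℝ f) x₀ v v = ‖L v‖ ^ 2 := fun v => by
    have hv : v = ∑ i, v i • EuclideanSpace.single i (1 : ℝ) := by
      simpa using ((EuclideanSpace.basisFun (Fin n) ℝ).sum_repr v).symm
    rw [hLH, hH]
    conv_lhs => rw [hv]
    simp only [map_sum, map_smul, sum_apply, smul_apply,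
      iteratedFDeriv_two_apply, dotProduct, Matrix.mulVec, Matrix.of_apply, smul_eq_mul,
      Matrix.cons_val_zero, Matrix.cons_val_one, Finset.mul_sum]
    rw [Finset.sum_comm]
    exact Finset.sum_congr rfl fun i _ => Finset.sum_congr rfl fun j _ => by ring
  have hL : (fun x => f x - 1 / 2 * ‖L (x - x₀)‖ ^ 2) =o[𝓝 x₀] fun x => ‖x - x₀‖ ^ 2 := by
    refine (hfU.contDiffAt hU).isLittleO_taylor_two.congr_left fun x => ?_
    rw [hquad, hf0, hmin.fderiv_eq_zero, zero_apply, sub_zero, sub_zero]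
  have hdet : 0 < √H.det := Real.sqrt_pos.2 hHpd.det_pos
  have hlim := (tendsto_rpow_mul_integral_mul_rexp_neg_mul hf_cont hfpos L hL hφc hφs).const_mul
    (((2 * Real.pi) ^ ((n : ℝ) / 2))⁻¹ * √H.det)
  rw [integral_rexp_neg_half_sq_norm_comp, hLdet, finrank_euclideanSpace_fin] at hlim
  have hpi : 0 < (2 * Real.pi) ^ ((n : ℝ) / 2) := by positivity
  convert hlim.congr' ?_ using 2
  · field_simp
  · filter_upwards [eventually_gt_atTop 0] with t ht
    rw [Real.div_rpow ht.le (by positivity), ← mul_assoc, ← integral_const_mul]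
    congr 1 with x
    ring
end

section
/- Let E be a finite-dimensional real inner product space, let a group W act on E by linear isometries, and let g : E → ℝ be differentiable, strictly convex and W-invariant. Then the gradient map ∇g : E → E is injective, and for every w ∈ W and ξ ∈ E one has w·(∇g(ξ)) = ∇g(ξ) if and only if w·ξ = ξ; in other words, Stab_W(∇g(ξ)) = Stab_W(ξ) for every ξ ∈ E. In particular ∇g maps the set of points with trivial W-stabilizer into itself. -/
/-- The derivative of a differentiable strictly convex function is injective. -/
theorem StrictConvexOn.injective_fderiv {E : Type*} [NormedAddCommGroup E] [NormedSpace ℝ E]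
    {g : E → ℝ} (hconv : StrictConvexOn ℝ Set.univ g) (hdiff : Differentiable ℝ g) :
    Function.Injective (fderiv ℝ g) := by
  intro ξ η h
  by_contra hne
  have hline : StrictConvexOn ℝ Set.univ (fun t : ℝ => g (AffineMap.lineMap ξ η t)) := by
    refine ⟨convex_univ, fun s _ t _ hst a b ha hb hab => ?_⟩
    have key := hconv.2 (Set.mem_univ (AffineMap.lineMap ξ η s))
      (Set.mem_univ (AffineMap.lineMap ξ η t))
      (fun heq => hst (AffineMap.lineMap_injective ℝ hne heq)) ha hb hab
    rwa [← Convex.combo_affine_apply hab] at key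
  have hderiv (t : ℝ) : HasDerivAt (fun t : ℝ => g (AffineMap.lineMap ξ η t))
      (fderiv ℝ g (AffineMap.lineMap ξ η t) (η - ξ)) t :=
    (hdiff _).hasFDerivAt.comp_hasDerivAt t AffineMap.hasDerivAt_lineMap
  have hlt := hline.strictMonoOn_deriv (fun t _ => (hderiv t).differentiableAt)
    (Set.mem_univ 0) (Set.mem_univ 1) one_pos
  simp [(hderiv _).deriv, h] at hlt

/-- The gradient of a differentiable strictly convex function is injective. -/
theorem StrictConvexOn.injective_gradient {E : Type*} [NormedAddCommGroup E]
    [InnerProductSpace ℝ E] [CompleteSpace E] {g : E → ℝ}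
    (hconv : StrictConvexOn ℝ Set.univ g) (hdiff : Differentiable ℝ g) :
    Function.Injective (gradient g) :=
  (InnerProductSpace.toDual ℝ E).symm.injective.comp (hconv.injective_fderiv hdiff)

/-- The gradient of a function invariant under a linear isometry commutes with that isometry. -/
theorem LinearIsometryEquiv.gradient_apply_of_invariant {E : Type*} [NormedAddCommGroup E]
    [InnerProductSpace ℝ E] [CompleteSpace E] (e : E ≃ₗᵢ[ℝ] E) {g : E → ℝ}
    (hinv : ∀ ξ, g (e ξ) = g ξ) (ξ : E) :
    gradient g (e ξ) = e (gradient g ξ) := by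
  have hfderiv := e.toContinuousLinearEquiv.comp_right_fderiv (f := g) (x := ξ)
  rw [show g ∘ e.toContinuousLinearEquiv = g from funext hinv] at hfderiv
  refine ext_inner_right ℝ fun v => ?_
  obtain ⟨u, rfl⟩ := e.surjective v
  rw [e.inner_map_map]
  simpa [gradient] using (DFunLike.congr_fun hfderiv u).symm

/-- Key step in the proof of Lemma 4.4: the gradient (Legendre transform) of a `W`-invariant
differentiable strictly convex function on a finite-dimensional real inner product space is
injective and preserves `W`-stabilizers: `w·∇g(ξ) = ∇g(ξ) ↔ w·ξ = ξ`. In particular it maps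
points with trivial stabilizer to points with trivial stabilizer. -/
theorem gradient_stabilizer_of_strictConvex_invariant
    {E : Type*} [NormedAddCommGroup E] [InnerProductSpace ℝ E] [FiniteDimensional ℝ E]
    {W : Type*} [Group W] (ρ : W →* (E ≃ₗᵢ[ℝ] E))
    (g : E → ℝ) (hdiff : Differentiable ℝ g)
    (hconv : StrictConvexOn ℝ Set.univ g)
    (hinv : ∀ (w : W) (ξ : E), g (ρ w ξ) = g ξ) :
    Function.Injective (gradient g) ∧
    (∀ (w : W) (ξ : E), ρ w (gradient g ξ) = gradient g ξ ↔ ρ w ξ = ξ) ∧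
    (∀ ξ : E, (∀ w : W, ρ w ξ = ξ → w = 1) →
      (∀ w : W, ρ w (gradient g ξ) = gradient g ξ → w = 1)) := by
  have hinj := hconv.injective_gradient hdiff
  have hstab (w : W) (ξ : E) : ρ w (gradient g ξ) = gradient g ξ ↔ ρ w ξ = ξ := by
    rw [← (ρ w).gradient_apply_of_invariant (hinv w), hinj.eq_iff]
  exact ⟨hinj, hstab, fun ξ h w hw => h w ((hstab w ξ).1 hw)⟩
end

section
/- Let E be a finite-dimensional real inner product space, let a finite group W act on E by linear isometries, and let g : E → ℝ be differentiable, strictly convex and W-invariant. Then for every ξ ∈ E and every s ∈ [0,1], the point (1−s)·ξ + s·∇g(ξ) has the same W-stabilizer as ξ. Consequently, if ξ has trivial W-stabilizer, then ∇g(ξ) lies in the same connected component of the open set E_reg := {η ∈ E : Stab_W(η) = {e}} as ξ; in particular ∇g maps each open Weyl chamber (connected component of E_reg) into itself. -/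
open AffineMap InnerProductSpace

section Gradient

variable {E : Type*} [NormedAddCommGroup E] [InnerProductSpace ℝ E] [CompleteSpace E]

/-- The gradient of a differentiable strictly convex function is strictly monotone. -/
theorem StrictConvexOn.inner_gradient_sub_pos {g : E → ℝ} (hconv : StrictConvexOn ℝ Set.univ g)
    (hdiff : Differentiable ℝ g) {x y : E} (hxy : x ≠ y) :
    0 < inner ℝ (gradient g y - gradient g x) (y - x) := by
  have hline : StrictConvexOn ℝ Set.univ (fun t : ℝ => g (lineMap x y t)) := by
    refine ⟨convex_univ, fun a _ b _ hab p q hp hq hpq => ?_⟩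
    have h := hconv.2 (Set.mem_univ _) (Set.mem_univ _)
      ((lineMap_injective ℝ hxy).ne hab) hp hq hpq
    rwa [← Convex.combo_affine_apply hpq] at h
  have hderiv (t : ℝ) : HasDerivAt (fun t : ℝ => g (lineMap x y t))
      (inner ℝ (gradient g (lineMap x y t)) (y - x)) t := by
    rw [inner_gradient_left]
    exact (hdiff _).hasFDerivAt.comp_hasDerivAt t hasDerivAt_lineMap
  have hlt := (hline.lt_slope_of_hasDerivAt (Set.mem_univ 0) (Set.mem_univ 1) zero_lt_one
    (hderiv 0)).trans (hline.slope_lt_of_hasDerivAt (Set.mem_univ 0) (Set.mem_univ 1) zero_lt_one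
    (hderiv 1))
  rw [lineMap_apply_zero, lineMap_apply_one] at hlt
  rwa [inner_sub_left, sub_pos]

/-- The gradient of a differentiable function invariant under a linear isometry commutes with that
isometry. -/
theorem LinearIsometryEquiv.gradient_apply_of_invariant_s6 {g : E → ℝ} (hdiff : Differentiable ℝ g)
    (e : E ≃ₗᵢ[ℝ] E) (hinv : ∀ x, g (e x) = g x) (x : E) :
    gradient g (e x) = e (gradient g x) := by
  refine ext_inner_right ℝ fun v => ?_
  obtain ⟨u, rfl⟩ := e.surjective v
  have hcomp : HasFDerivAt (fun z => g (e z))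
      ((fderiv ℝ g (e x)).comp (e : E →L[ℝ] E)) x :=
    (hdiff (e x)).hasFDerivAt.comp x e.toContinuousLinearEquiv.hasFDerivAt
  rw [funext hinv] at hcomp
  rw [e.inner_map_map, inner_gradient_left, inner_gradient_left, hcomp.fderiv]
  rfl

/-- A linear isometry preserving a differentiable strictly convex function `g` fixes a point of the
segment from `x` to the gradient of `g` at `x` if and only if it fixes `x`. -/
theorem StrictConvexOn.isometry_fixes_segment_gradient_iff {g : E → ℝ}
    (hconv : StrictConvexOn ℝ Set.univ g) (hdiff : Differentiable ℝ g)
    (e : E ≃ₗᵢ[ℝ] E) (hinv : ∀ x, g (e x) = g x) (x : E) {s : ℝ} (hs : s ∈ Set.Icc (0 : ℝ) 1) :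
    e ((1 - s) • x + s • gradient g x) = (1 - s) • x + s • gradient g x ↔ e x = x := by
  have hgrad := e.gradient_apply_of_invariant_s6 hdiff hinv x
  rw [map_add, map_smul, map_smul, ← hgrad]
  refine ⟨fun h => ?_, fun h => by rw [h]⟩
  by_contra hne
  have hmono := hconv.inner_gradient_sub_pos hdiff (Ne.symm hne)
  have hnorm : 0 < inner ℝ (e x - x) (e x - x) := real_inner_self_pos.2 (sub_ne_zero.2 hne)
  have hzero : (1 - s) * inner ℝ (e x - x) (e x - x) +
      s * inner ℝ (gradient g (e x) - gradient g x) (e x - x) = 0 := by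
    rw [← real_inner_smul_left, ← real_inner_smul_left, ← inner_add_left,
      smul_sub, smul_sub, sub_add_sub_comm, h, sub_self, inner_zero_left]
  rcases hs.1.eq_or_lt with rfl | hpos
  · linarith
  · nlinarith [mul_nonneg (sub_nonneg.2 hs.2) hnorm.le, mul_pos hpos hmono]

end Gradient

/-- For a finite group `W` acting by linear isometries on a finite-dimensional real inner
product space and a `W`-invariant differentiable strictly convex function `g`, every point on
the segment from `ξ` to `∇g(ξ)` has the same `W`-stabilizer as `ξ`; consequently, if `ξ` has
trivial stabilizer, then `∇g(ξ)` lies in the same connected component of the open set of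
points with trivial stabilizer (the open Weyl chamber) as `ξ`. -/
theorem gradient_preserves_chamber
    {E : Type*} [NormedAddCommGroup E] [InnerProductSpace ℝ E] [FiniteDimensional ℝ E]
    {W : Type*} [Group W] [Finite W] (ρ : W →* (E ≃ₗᵢ[ℝ] E))
    (g : E → ℝ) (hdiff : Differentiable ℝ g)
    (hconv : StrictConvexOn ℝ Set.univ g)
    (hinv : ∀ (w : W) (ξ : E), g (ρ w ξ) = g ξ) :
    (∀ (ξ : E) (s : ℝ), s ∈ Set.Icc (0 : ℝ) 1 →
      ∀ w : W, ρ w ((1 - s) • ξ + s • gradient g ξ) = (1 - s) • ξ + s • gradient g ξ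
        ↔ ρ w ξ = ξ) ∧
    (∀ ξ : E, ξ ∈ {η : E | ∀ w : W, ρ w η = η → w = 1} →
      gradient g ξ ∈ connectedComponentIn {η : E | ∀ w : W, ρ w η = η → w = 1} ξ) := by
  have hstab (ξ : E) (s : ℝ) (hs : s ∈ Set.Icc (0 : ℝ) 1) (w : W) :=
    hconv.isometry_fixes_segment_gradient_iff hdiff (ρ w) (hinv w) ξ hs
  refine ⟨hstab, fun ξ hξ => ?_⟩
  refine (convex_segment ξ (gradient g ξ)).isPreconnected.subset_connectedComponentIn
    (left_mem_segment ℝ _ _) ?_ (right_mem_segment ℝ _ _)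
  rw [segment_eq_image]
  rintro _ ⟨s, hs, rfl⟩ w hw
  exact hξ w ((hstab ξ s hs w).1 hw)
end

section
/- Let E be a finite-dimensional real inner product space, let a finite group W act on E by linear isometries, and let g : E → ℝ be differentiable, strictly convex and W-invariant. Let C be a connected component of the set E_reg := {η ∈ E : Stab_W(η) = {e}} of points with trivial stabilizer, let ξ ∈ C, and let λ ∈ E satisfy ⟨w·λ, η⟩ < ⟨λ, η⟩ for every η ∈ C and every w ∈ W with w·λ ≠ λ. Then for every ν in the convex hull of the orbit W·λ := {w·λ : w ∈ W} with ν ≠ λ, one has ⟨λ − ν, ∇g(ξ)⟩ > 0. -/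
open scoped RealInnerProductSpace

section GradientOfConvex

variable {E : Type*} [NormedAddCommGroup E] [InnerProductSpace ℝ E]

/-- The gradient inequality: a convex function lies above its tangent hyperplanes. -/
theorem ConvexOn.add_inner_gradient_le [CompleteSpace E] {g : E → ℝ}
    (hg : ConvexOn ℝ Set.univ g) {x : E} (hx : DifferentiableAt ℝ g x) (y : E) :
    g x + ⟪gradient g x, y - x⟫ ≤ g y := by
  have hline : ConvexOn ℝ Set.univ (g ∘ AffineMap.lineMap (k := ℝ) x y) :=
    hg.comp_affineMap (AffineMap.lineMap x y)
  have hderiv : HasDerivAt (g ∘ AffineMap.lineMap (k := ℝ) x y) ⟪gradient g x, y - x⟫ 0 := by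
    have h := hx.hasGradientAt.hasFDerivAt
    rw [← AffineMap.lineMap_apply_zero (k := ℝ) x y] at h
    simpa using h.comp_hasDerivAt (0 : ℝ) AffineMap.hasDerivAt_lineMap
  have h := hline.le_slope_of_hasDerivAt (Set.mem_univ 0) (Set.mem_univ 1) zero_lt_one hderiv
  simp only [slope_def_field, Function.comp_apply, AffineMap.lineMap_apply_one,
    AffineMap.lineMap_apply_zero, sub_zero, div_one] at h
  linarith

/-- The gradient inequality for strictly convex functions. -/
theorem StrictConvexOn.add_inner_gradient_lt [CompleteSpace E] {g : E → ℝ}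
    (hg : StrictConvexOn ℝ Set.univ g) {x y : E} (hx : DifferentiableAt ℝ g x) (hxy : x ≠ y) :
    g x + ⟪gradient g x, y - x⟫ < g y := by
  have hlt := hg.2 (Set.mem_univ x) (Set.mem_univ y) hxy
    (half_pos one_pos) (half_pos one_pos) (add_halves 1)
  have hle := hg.convexOn.add_inner_gradient_le hx ((1 / 2 : ℝ) • x + (1 / 2 : ℝ) • y)
  have hmid : (1 / 2 : ℝ) • x + (1 / 2 : ℝ) • y - x = (1 / 2 : ℝ) • (y - x) := by module
  rw [hmid, real_inner_smul_right] at hle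
  simp only [smul_eq_mul] at hlt
  linarith

/-- If a linear isometry preserves the value of a strictly convex function at `x` and fixes some
point of the segment from `x` to the gradient at `x`, then it fixes `x`. -/
theorem StrictConvexOn.apply_eq_self_of_mem_segment_gradient [CompleteSpace E] {g : E → ℝ}
    (hg : StrictConvexOn ℝ Set.univ g) {x : E} (hx : DifferentiableAt ℝ g x)
    {T : E ≃ₗᵢ[ℝ] E} (hT : g (T x) = g x) {η : E} (hη : η ∈ segment ℝ x (gradient g x))
    (hfix : T η = η) : T x = x := by
  by_contra hne
  obtain ⟨a, b, ha, hb, hab, rfl⟩ := hη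
  have hgrad := hg.add_inner_gradient_lt hx (Ne.symm hne)
  rw [hT, inner_sub_right] at hgrad
  have hself : ⟪x, T x⟫ < ⟪x, x⟫ := by
    have h := norm_sub_sq_real x (T x)
    have hpos : 0 < ‖x - T x‖ ^ 2 := by
      have := norm_pos_iff.2 (sub_ne_zero.2 (Ne.symm hne))
      positivity
    rw [T.norm_map] at h
    rw [real_inner_self_eq_norm_sq]
    linarith
  have heq := T.inner_map_map (a • x + b • gradient g x) x
  rw [hfix] at heq
  simp only [inner_add_left, real_inner_smul_left] at heq
  rcases ha.eq_or_lt with rfl | ha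
  · nlinarith
  · nlinarith

end GradientOfConvex

/-- If a linear functional is strictly smaller at every point of `s` other than `x` than at `x`,
then the same holds on the convex hull of `s`. -/
theorem inner_lt_of_mem_convexHull {E : Type*} [NormedAddCommGroup E] [InnerProductSpace ℝ E]
    {s : Set E} {x η : E} (hs : ∀ y ∈ s, y ≠ x → ⟪y, η⟫ < ⟪x, η⟫) :
    ∀ y ∈ convexHull ℝ s, y ≠ x → ⟪y, η⟫ < ⟪x, η⟫ := by
  suffices h : Convex ℝ {y : E | y ≠ x → ⟪y, η⟫ < ⟪x, η⟫} from
    fun y hy => convexHull_min hs h hy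
  rw [convex_iff_forall_pos]
  intro y hy z hz a b ha hb hab hne
  simp only [Set.mem_ofPred_eq] at hy hz
  have hx : ⟪x, η⟫ = a * ⟪x, η⟫ + b * ⟪x, η⟫ := by rw [← add_mul, hab, one_mul]
  rw [inner_add_left, real_inner_smul_left, real_inner_smul_left, hx]
  by_cases hyx : y = x
  · subst hyx
    have hzy : z ≠ y := fun h => hne (by rw [h, ← add_smul, hab, one_smul])
    have := mul_lt_mul_of_pos_left (hz hzy) hb
    linarith
  · have hylt := mul_lt_mul_of_pos_left (hy hyx) ha
    have hzle : ⟪z, η⟫ ≤ ⟪x, η⟫ := by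
      by_cases hzx : z = x
      · rw [hzx]
      · exact (hz hzx).le
    have := mul_le_mul_of_nonneg_left hzle hb.le
    linarith

/-- Lemma 4.4 of the paper, abstractly: let a finite group `W` act by linear isometries on a
finite-dimensional real inner product space `E`, let `g` be differentiable, strictly convex
and `W`-invariant, let `C` be the connected component of the set `E_reg` of points with
trivial stabilizer containing a point `ξ`, and let `lam` be dominant with respect to `C`
(i.e. `⟪w·lam, η⟫ < ⟪lam, η⟫` for all `η ∈ C` and all `w` with `w·lam ≠ lam`). Then
`⟪lam − ν, ∇g(ξ)⟫ > 0` for every `ν ≠ lam` in the convex hull of the orbit `W·lam`. -/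
theorem inner_gradient_pos_of_dominant
    {E : Type*} [NormedAddCommGroup E] [InnerProductSpace ℝ E] [FiniteDimensional ℝ E]
    {W : Type*} [Group W] [Finite W] (ρ : W →* (E ≃ₗᵢ[ℝ] E))
    (g : E → ℝ) (hdiff : Differentiable ℝ g)
    (hconv : StrictConvexOn ℝ Set.univ g)
    (hinv : ∀ (w : W) (ξ : E), g (ρ w ξ) = g ξ)
    (Ereg : Set E) (hEreg : Ereg = {η : E | ∀ w : W, ρ w η = η → w = 1})
    (ξ : E) (hξ : ξ ∈ Ereg)
    (C : Set E) (hC : C = connectedComponentIn Ereg ξ)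
    (lam : E)
    (hdom : ∀ η ∈ C, ∀ w : W, ρ w lam ≠ lam → ⟪ρ w lam, η⟫ < ⟪lam, η⟫) :
    ∀ ν ∈ convexHull ℝ (Set.range fun w : W => ρ w lam), ν ≠ lam →
      0 < ⟪lam - ν, gradient g ξ⟫ := by
  subst hEreg hC
  have hseg : segment ℝ ξ (gradient g ξ) ⊆ {η : E | ∀ w : W, ρ w η = η → w = 1} :=
    fun η hη w hw =>
      hξ w (hconv.apply_eq_self_of_mem_segment_gradient (hdiff ξ) (hinv w ξ) hη hw)
  have hmem := (convex_segment ξ (gradient g ξ)).isPreconnected.subset_connectedComponentIn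
    (left_mem_segment ℝ _ _) hseg (right_mem_segment ℝ _ _)
  intro ν hν hne
  rw [inner_sub_left, sub_pos]
  refine inner_lt_of_mem_convexHull ?_ ν hν hne
  rintro _ ⟨w, rfl⟩ hw
  exact hdom _ hmem w hw
end
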